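/- arXiv:1511.03766 — 2 statements merged into one kernel-verified Lean document; each statement's English description precedes it below -/
import Mathlib

section
/- Let λ̃ be a maximizer over Δ of the function λ ↦ −h(λ) − w*ᵀ A R Rᵀ λ − γ_λ‖λ‖₁, where λ* ∈ Δ maximizes λ ↦ −h(λ) − w*ᵀAλ over Δ (equivalently, there is a gradient/subgradient ∇h(λ*) with ⟨−∇h(λ*) − Aᵀw*, λ − λ*⟩ ≤ 0 for all λ ∈ Δ). Set ρ_λ = ‖(R Rᵀ − I) Aᵀ w*‖_∞. If γ_λ ≥ 2 ρ_λ, then ‖λ̃ − λ*‖₂ ≤ 3 γ_λ √s_λ / β, ‖λ̃ − λ*‖₁ ≤ 12 γ_λ s_λ / β, and ‖λ̃ − λ*‖₁ ≤ 4 √s_λ · ‖λ̃ − λ*‖₂. -/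
open Matrix

/-- Euclidean (ℓ2) norm of a vector. -/
noncomputable def norm2 {k : ℕ} (x : Fin k → ℝ) : ℝ := Real.sqrt (∑ i, (x i) ^ 2)

/-- ℓ1 norm of a vector. -/
noncomputable def norm1 {k : ℕ} (x : Fin k → ℝ) : ℝ := ∑ i, |x i|

/-- ℓ∞ norm of a vector. -/
noncomputable def normInf {k : ℕ} (x : Fin k → ℝ) : ℝ := ⨆ i, |x i|

/-- Number of nonzero entries of a vector. -/
noncomputable def norm0 {k : ℕ} (x : Fin k → ℝ) : ℕ :=
  (Finset.univ.filter fun i => x i ≠ 0).card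

/-- `f` is `μ`-strongly convex with respect to the Euclidean norm. -/
def StronglyConvex {k : ℕ} (μ : ℝ) (f : (Fin k → ℝ) → ℝ) : Prop :=
  ∀ x y : Fin k → ℝ, ∀ t : ℝ, 0 ≤ t → t ≤ 1 →
    f (t • x + (1 - t) • y) ≤
      t * f x + (1 - t) * f y - μ / 2 * (t * (1 - t)) * (norm2 (x - y)) ^ 2

/-- Quadratic growth at a minimizer of the sum of a strongly convex and a convex function. -/
lemma StronglyConvex.quadratic_growth {k : ℕ} {μ : ℝ} {f φ : (Fin k → ℝ) → ℝ}
    (hf : StronglyConvex μ f) {s : Set (Fin k → ℝ)} (hφ : ConvexOn ℝ s φ) {x y : Fin k → ℝ}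
    (hx : x ∈ s) (hy : y ∈ s) (hmin : ∀ z ∈ s, f x + φ x ≤ f z + φ z) :
    f x + φ x + μ / 2 * norm2 (y - x) ^ 2 ≤ f y + φ y := by
  have key : ∀ t : ℝ, 0 < t → t ≤ 1 →
      (1 - t) * (μ / 2 * norm2 (y - x) ^ 2) ≤ f y + φ y - (f x + φ x) := by
    intro t ht ht1
    have hz := hmin _ (hφ.1 hy hx ht.le (sub_nonneg.2 ht1) (by ring))
    have hfz := hf y x t ht.le ht1
    have hφz := hφ.2 hy hx ht.le (sub_nonneg.2 ht1) (by ring)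
    simp only [smul_eq_mul] at hφz
    refine le_of_mul_le_mul_left ?_ ht
    linarith
  set K := μ / 2 * norm2 (y - x) ^ 2
  set c := f y + φ y - (f x + φ x) with hc
  suffices K ≤ c by linarith
  by_contra! hlt
  have hc0 : 0 ≤ c := by simpa using key 1 one_pos le_rfl
  have hK : 0 < K := hc0.trans_lt hlt
  have ht := key ((K - c) / (2 * K)) (div_pos (by linarith) (by linarith))
    (by rw [div_le_one (by linarith)]; linarith)
  have hmid : (1 - (K - c) / (2 * K)) * K = (K + c) / 2 := by field_simp; ring
  linarith

lemma convexOn_norm1 {k : ℕ} : ConvexOn ℝ Set.univ (norm1 (k := k)) := by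
  refine ⟨convex_univ, fun x _ y _ a b ha hb _ => ?_⟩
  simp only [norm1, smul_eq_mul, Finset.mul_sum, ← Finset.sum_add_distrib]
  refine Finset.sum_le_sum fun i _ => (abs_add_le _ _).trans_eq ?_
  simp [abs_mul, abs_of_nonneg ha, abs_of_nonneg hb]

lemma convexOn_dotProduct {k : ℕ} (v : Fin k → ℝ) :
    ConvexOn ℝ Set.univ (fun x : Fin k → ℝ => v ⬝ᵥ x) :=
  ⟨convex_univ, fun x _ y _ a b _ _ _ => by simp [dotProduct_add, dotProduct_smul]⟩

lemma abs_dotProduct_le_normInf_mul_norm1 {k : ℕ} (v x : Fin k → ℝ) :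
    |v ⬝ᵥ x| ≤ normInf v * norm1 x := by
  rw [norm1, Finset.mul_sum]
  refine (Finset.abs_sum_le_sum_abs _ _).trans (Finset.sum_le_sum fun i _ => ?_)
  rw [abs_mul]
  exact mul_le_mul_of_nonneg_right
    (le_ciSup (f := fun j => |v j|) (Set.finite_range _).bddAbove i) (abs_nonneg _)

/-- Cauchy–Schwarz on a subset of the coordinates. -/
lemma sum_abs_le_sqrt_card_mul_norm2 {k : ℕ} (S : Finset (Fin k)) (x : Fin k → ℝ) :
    ∑ i ∈ S, |x i| ≤ √(S.card : ℝ) * norm2 x := by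
  rw [norm2, ← Real.sqrt_mul (Nat.cast_nonneg _)]
  refine Real.le_sqrt_of_sq_le (sq_sum_le_card_mul_sum_sq.trans ?_)
  simp only [sq_abs]
  gcongr
  exact Finset.subset_univ S

/-- Decomposability of the ℓ1 norm with respect to the support of `x`. -/
lemma norm1_sub_norm1_le {k : ℕ} (x y : Fin k → ℝ) :
    norm1 x - norm1 y ≤ 2 * ∑ i with x i ≠ 0, |(y - x) i| - norm1 (y - x) := by
  simp only [norm1, Finset.sum_filter, Finset.mul_sum, ← Finset.sum_sub_distrib]
  refine Finset.sum_le_sum fun i _ => ?_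
  by_cases hi : x i = 0
  · simp [hi]
  · have := abs_sub_abs_le_abs_sub (x i) (y i)
    rw [abs_sub_comm] at this
    simp only [ne_eq, hi, not_false_eq_true, if_true, Pi.sub_apply]
    linarith

theorem dual_pseudo_solution_bound
    {d n m : ℕ}
    (A : Matrix (Fin d) (Fin n) ℝ)
    (Δ : Set (Fin n → ℝ))
    (h : (Fin n → ℝ) → ℝ)
    (β γl : ℝ)
    (R : Matrix (Fin n) (Fin m) ℝ)
    (wstar : Fin d → ℝ) (lstar ltil : Fin n → ℝ)
    (hΔ : Convex ℝ Δ)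
    (hβ : 0 < β) (hγl : 0 < γl)
    (hh : StronglyConvex β h)
    (hlΔ : lstar ∈ Δ) (hltilΔ : ltil ∈ Δ)
    -- λ* maximizes λ ↦ −h(λ) − w*ᵀAλ over Δ
    (hlstar : ∀ lam ∈ Δ,
      -h lam - wstar ⬝ᵥ (A *ᵥ lam) ≤ -h lstar - wstar ⬝ᵥ (A *ᵥ lstar))
    -- λ̃ maximizes λ ↦ −h(λ) − w*ᵀ A R Rᵀ λ − γ_λ‖λ‖₁ over Δ
    (hltil : ∀ lam ∈ Δ,
      -h lam - wstar ⬝ᵥ (A *ᵥ (R *ᵥ (Rᵀ *ᵥ lam))) - γl * norm1 lam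
        ≤ -h ltil - wstar ⬝ᵥ (A *ᵥ (R *ᵥ (Rᵀ *ᵥ ltil))) - γl * norm1 ltil)
    -- γ_λ ≥ 2 ρ_λ where ρ_λ = ‖(R Rᵀ − I) Aᵀ w*‖_∞
    (hγ : 2 * normInf ((R * Rᵀ - 1) *ᵥ (Aᵀ *ᵥ wstar)) ≤ γl) :
    norm2 (ltil - lstar) ≤ 3 * γl * Real.sqrt (norm0 lstar) / β ∧
    norm1 (ltil - lstar) ≤ 12 * γl * (norm0 lstar : ℝ) / β ∧
    norm1 (ltil - lstar) ≤ 4 * Real.sqrt (norm0 lstar) * norm2 (ltil - lstar) := by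
  set u := ltil - lstar with hu
  set g := Aᵀ *ᵥ wstar
  have hg : ∀ x, wstar ⬝ᵥ (A *ᵥ x) = g ⬝ᵥ x := fun x => by
    rw [dotProduct_mulVec, ← mulVec_transpose]
  have hgR : ∀ x, wstar ⬝ᵥ (A *ᵥ (R *ᵥ (Rᵀ *ᵥ x))) = ((R * Rᵀ) *ᵥ g) ⬝ᵥ x := fun x => by
    rw [hg, mulVec_mulVec, dotProduct_mulVec, ← mulVec_transpose, transpose_mul,
      transpose_transpose]
  simp only [hgR] at hltil
  simp only [hg] at hlstar
  have growth_star := hh.quadratic_growth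
    ((convexOn_dotProduct g).subset (Set.subset_univ _) hΔ) hlΔ hltilΔ
    fun z hz => by linarith [hlstar z hz]
  have growth_til := hh.quadratic_growth
    (((convexOn_dotProduct ((R * Rᵀ) *ᵥ g)).add (convexOn_norm1.smul hγl.le)).subset
      (Set.subset_univ _) hΔ) hltilΔ hlΔ
    fun z hz => by
      simp only [Pi.add_apply, smul_eq_mul]
      linarith [hltil z hz]
  simp only [Pi.add_apply, smul_eq_mul] at growth_til
  have hsymm : norm2 (lstar - ltil) = norm2 u := by
    simp only [norm2, hu, Pi.sub_apply]
    congr 1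
    exact Finset.sum_congr rfl fun i _ => by ring
  rw [hsymm] at growth_til
  rw [← hu] at growth_star
  have hdual := (neg_le_abs _).trans
    (abs_dotProduct_le_normInf_mul_norm1 ((R * Rᵀ - 1) *ᵥ g) u)
  have hexpand : ((R * Rᵀ - 1) *ᵥ g) ⬝ᵥ u = ((R * Rᵀ) *ᵥ g) ⬝ᵥ ltil
      - ((R * Rᵀ) *ᵥ g) ⬝ᵥ lstar - g ⬝ᵥ ltil + g ⬝ᵥ lstar := by
    rw [hu, sub_mulVec, one_mulVec, sub_dotProduct, dotProduct_sub, dotProduct_sub]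
    ring
  have hu1 : 0 ≤ norm1 u := Finset.sum_nonneg fun i _ => abs_nonneg _
  have hu2 : 0 ≤ norm2 u := Real.sqrt_nonneg _
  have hρ := mul_le_mul_of_nonneg_right hγ hu1
  have hdec := mul_le_mul_of_nonneg_left (norm1_sub_norm1_le lstar ltil) hγl.le
  have hCS : _ ≤ √(norm0 lstar : ℝ) * norm2 u :=
    sum_abs_le_sqrt_card_mul_norm2 (Finset.univ.filter fun i => lstar i ≠ 0) u
  rw [← hu] at hdec
  set T := ∑ i with lstar i ≠ 0, |u i|
  have hbasic : β * norm2 u ^ 2 ≤ γl * (2 * T - norm1 u / 2) := by linarith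
  have hcone : norm1 u ≤ 4 * T := by
    have := nonneg_of_mul_nonneg_right ((by positivity : 0 ≤ β * norm2 u ^ 2).trans hbasic) hγl
    linarith
  have hell1 : norm1 u ≤ 4 * √(norm0 lstar : ℝ) * norm2 u := by linarith
  have hell2 : norm2 u ≤ 3 * γl * √(norm0 lstar : ℝ) / β := by
    rw [le_div_iff₀ hβ]
    rcases hu2.eq_or_lt with h0 | hpos
    · rw [← h0, zero_mul]
      positivity
    · refine le_of_mul_le_mul_right ?_ hpos
      have := mul_le_mul_of_nonneg_left (by linarith : 2 * T - norm1 u / 2 ≤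
        3 * (√(norm0 lstar : ℝ) * norm2 u)) hγl.le
      linarith
  refine ⟨hell2, hell1.trans ?_, hell1⟩
  calc 4 * √(norm0 lstar : ℝ) * norm2 u
      ≤ 4 * √(norm0 lstar : ℝ) * (3 * γl * √(norm0 lstar : ℝ) / β) := by gcongr
    _ = 12 * γl * (√(norm0 lstar : ℝ) * √(norm0 lstar : ℝ)) / β := by ring
    _ = 12 * γl * (norm0 lstar : ℝ) / β := by rw [Real.mul_self_sqrt (Nat.cast_nonneg _)]
end

section
/- Let λ̃ be a maximizer over Δ of λ ↦ −h(λ) − w*ᵀ A R Rᵀ λ − γ_λ‖λ‖₁. Suppose (w*', λ*') is such that λ*' lies in the interior of Δ and satisfies the first-order optimality condition ∇h(λ*') + Aᵀ w*' = 0; suppose h is μ-smooth, every column of A has ℓ2-norm at most 1, and ‖w* − w*'‖₂ ≤ τ and ‖λ* − λ*'‖₂ ≤ τ. Set ρ_λ = ‖(R Rᵀ − I) Aᵀ w*‖_∞ + (1+μ)τ. If γ_λ ≥ 2 ρ_λ, then ‖λ̃ − λ*‖₂ ≤ 3 γ_λ √s_λ / β, ‖λ̃ − λ*‖₁ ≤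 12 γ_λ s_λ / β, and ‖λ̃ − λ*‖₁ ≤ 4 √s_λ · ‖λ̃ − λ*‖₂. -/
open Matrix

/-- `Df` is the gradient of `f` (w.r.t. the Euclidean inner product), characterized via
directional derivatives. -/
def IsGradient {k : ℕ} (f : (Fin k → ℝ) → ℝ) (Df : (Fin k → ℝ) → (Fin k → ℝ)) : Prop :=
  ∀ x v : Fin k → ℝ, HasDerivAt (fun t : ℝ => f (x + t • v)) (Df x ⬝ᵥ v) 0

lemma norm2_nonneg {k : ℕ} (x : Fin k → ℝ) : 0 ≤ norm2 x := Real.sqrt_nonneg _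

lemma abs_apply_le_norm2 {k : ℕ} (x : Fin k → ℝ) (i : Fin k) : |x i| ≤ norm2 x :=
  Real.abs_le_sqrt
    (Finset.single_le_sum (f := fun i => x i ^ 2) (fun _ _ => sq_nonneg _) (Finset.mem_univ i))

lemma abs_dotProduct_le_norm2_mul_norm2 {k : ℕ} (x y : Fin k → ℝ) :
    |x ⬝ᵥ y| ≤ norm2 x * norm2 y := by
  rw [norm2, norm2, ← Real.sqrt_mul (Finset.sum_nonneg fun _ _ => sq_nonneg _)]
  exact Real.abs_le_sqrt (Finset.sum_mul_sq_le_sq_mul_sq _ _ _)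

lemma abs_apply_le_normInf {k : ℕ} (x : Fin k → ℝ) (i : Fin k) : |x i| ≤ normInf x :=
  le_ciSup (f := fun i => |x i|) (Set.finite_range _).bddAbove i

/-- Hölder's inequality for a vector with uniformly bounded entries. -/
lemma abs_dotProduct_le_mul_norm1 {k : ℕ} {x : Fin k → ℝ} {c : ℝ} (hx : ∀ i, |x i| ≤ c)
    (y : Fin k → ℝ) : |x ⬝ᵥ y| ≤ c * norm1 y := by
  rw [norm1, Finset.mul_sum]
  refine (Finset.abs_sum_le_sum_abs _ _).trans (Finset.sum_le_sum fun i _ => ?_)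
  rw [abs_mul]
  exact mul_le_mul_of_nonneg_right (hx i) (abs_nonneg _)

/-- The `ℓ1` mass of `v` on the support of `l` is at most `√‖l‖₀ · ‖v‖₂`. -/
lemma sum_abs_support_le {k : ℕ} (l v : Fin k → ℝ) :
    ∑ i with l i ≠ 0, |v i| ≤ Real.sqrt (norm0 l) * norm2 v := by
  rw [norm2, ← Real.sqrt_mul (Nat.cast_nonneg _)]
  refine Real.le_sqrt_of_sq_le (sq_sum_le_card_mul_sum_sq.trans ?_)
  simp only [sq_abs]
  refine mul_le_mul_of_nonneg_left ?_ (Nat.cast_nonneg _)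
  exact Finset.sum_le_sum_of_subset_of_nonneg (Finset.filter_subset _ _)
    fun _ _ _ => sq_nonneg _

lemma sum_abs_support_le_norm1 {k : ℕ} (l v : Fin k → ℝ) :
    ∑ i with l i ≠ 0, |v i| ≤ norm1 v :=
  Finset.sum_le_sum_of_subset_of_nonneg (Finset.filter_subset _ _) fun _ _ _ => abs_nonneg _

lemma norm1_sub_two_mul_sum_abs_support_le {k : ℕ} (l y : Fin k → ℝ) :
    norm1 (y - l) - 2 * ∑ i with l i ≠ 0, |(y - l) i| ≤ norm1 y - norm1 l := by
  simp only [norm1, Finset.sum_filter, Finset.mul_sum, ← Finset.sum_sub_distrib]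
  refine Finset.sum_le_sum fun i _ => ?_
  by_cases hi : l i = 0
  · simp [hi]
  · have := abs_sub_abs_le_abs_sub (l i) (y i)
    rw [abs_sub_comm] at this
    simp only [hi, Pi.sub_apply, ne_eq, not_false_eq_true, if_true]
    linarith

/-- First-order lower bound for a differentiable strongly convex function. -/
lemma StronglyConvex.add_dotProduct_add_le {k : ℕ} {β : ℝ} {f : (Fin k → ℝ) → ℝ}
    {Df : (Fin k → ℝ) → (Fin k → ℝ)} (hf : StronglyConvex β f) (hDf : IsGradient f Df)
    (x y : Fin k → ℝ) :
    f x + Df x ⬝ᵥ (y - x) + β / 2 * norm2 (y - x) ^ 2 ≤ f y := by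
  have hslope := (hDf x (y - x)).tendsto_slope_zero_right
  have hbound : Filter.Tendsto (fun t : ℝ => f y - f x - β / 2 * (1 - t) * norm2 (y - x) ^ 2)
      (nhdsWithin 0 (Set.Ioi 0)) (nhds (f y - f x - β / 2 * (1 - 0) * norm2 (y - x) ^ 2)) := by
    apply Filter.Tendsto.mono_left _ nhdsWithin_le_nhds
    exact Continuous.tendsto (by fun_prop) 0
  have key := le_of_tendsto_of_tendsto hslope hbound (by
    filter_upwards [Ioo_mem_nhdsGT (zero_lt_one' ℝ)] with t ht
    have hconv := hf y x t ht.1.le ht.2.le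
    have hpt : t • y + (1 - t) • x = x + t • (y - x) := by
      ext i
      simp only [Pi.add_apply, Pi.smul_apply, Pi.sub_apply, smul_eq_mul]
      ring
    rw [hpt] at hconv
    simp only [zero_add, zero_smul, add_zero, smul_eq_mul]
    rw [inv_mul_le_iff₀ ht.1]
    linarith)
  linarith

/-- Basic `ℓ1`-regularization argument: the conclusion of optimality, curvature and a gradient
bounded by half the regularization weight. -/
lemma sparse_error_bounds {k : ℕ} {β γ : ℝ} (hβ : 0 < β) (hγ : 0 < γ) {l y g : Fin k → ℝ}
    (hg : ∀ i, |g i| ≤ γ / 2)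
    (hopt : β / 2 * norm2 (y - l) ^ 2 + g ⬝ᵥ (y - l) + γ * (norm1 y - norm1 l) ≤ 0) :
    norm2 (y - l) ≤ 3 * γ * Real.sqrt (norm0 l) / β ∧
    norm1 (y - l) ≤ 12 * γ * (norm0 l : ℝ) / β ∧
    norm1 (y - l) ≤ 4 * Real.sqrt (norm0 l) * norm2 (y - l) := by
  have hholder := neg_le_of_abs_le (abs_dotProduct_le_mul_norm1 hg (y - l))
  have hdecomp := mul_le_mul_of_nonneg_left (norm1_sub_two_mul_sum_abs_support_le l y) hγ.le
  have hmass := sum_abs_support_le l (y - l)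
  have hle := sum_abs_support_le_norm1 l (y - l)
  have hnn := norm2_nonneg (y - l)
  have hs := Real.sqrt_nonneg (norm0 l : ℝ)
  have hsq := Real.mul_self_sqrt (Nat.cast_nonneg (α := ℝ) (norm0 l))
  set T := ∑ i with l i ≠ 0, |(y - l) i|
  set N := norm1 (y - l)
  set V := norm2 (y - l)
  set s := Real.sqrt (norm0 l : ℝ)
  have hcurv : β / 2 * V ^ 2 ≤ γ * (2 * T - N / 2) := by linarith
  have hcone : N ≤ 4 * T := by
    have : 0 ≤ γ * (2 * T - N / 2) := le_trans (by positivity) hcurv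
    linarith [nonneg_of_mul_nonneg_right this hγ]
  have hN : N ≤ 4 * s * V := by linarith
  have hV : V ≤ 3 * γ * s / β := by
    rw [le_div_iff₀ hβ]
    rcases hnn.eq_or_lt with hV0 | hVpos
    · rw [← hV0, zero_mul]
      positivity
    · have : γ * (2 * T - N / 2) ≤ γ * (3 / 2 * (s * V)) :=
        mul_le_mul_of_nonneg_left (by linarith) hγ.le
      refine le_of_mul_le_mul_right ?_ hVpos
      linarith
  refine ⟨hV, hN.trans ?_, hN⟩
  calc 4 * s * V ≤ 4 * s * (3 * γ * s / β) := mul_le_mul_of_nonneg_left hV (by positivity)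
    _ = 12 * γ * (s * s) / β := by ring
    _ = 12 * γ * (norm0 l : ℝ) / β := by rw [hsq]

/-- A Lipschitz constant for `norm2` on a space of positive dimension is nonnegative. -/
lemma nonneg_of_norm2_sub_le {k : ℕ} [NeZero k] {μ : ℝ} {F : (Fin k → ℝ) → (Fin k → ℝ)}
    (hF : ∀ x y, norm2 (F x - F y) ≤ μ * norm2 (x - y)) : 0 ≤ μ := by
  refine nonneg_of_mul_nonneg_left ((norm2_nonneg _).trans (hF 1 0)) ?_
  have := abs_apply_le_norm2 (1 - 0 : Fin k → ℝ) 0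
  simp only [Pi.sub_apply, Pi.one_apply, Pi.zero_apply, sub_zero, abs_one] at this
  simpa using lt_of_lt_of_le one_pos this

theorem dual_pseudo_solution_bound_approx_sparse
    {d n m : ℕ}
    (A : Matrix (Fin d) (Fin n) ℝ)
    (Δ : Set (Fin n → ℝ))
    (h : (Fin n → ℝ) → ℝ) (Dh : (Fin n → ℝ) → (Fin n → ℝ))
    (β γl μ τ : ℝ)
    (R : Matrix (Fin n) (Fin m) ℝ)
    (wstar wstar' : Fin d → ℝ) (lstar lstar' ltil : Fin n → ℝ)
    -- every column of A has ℓ2-norm at most 1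
    (hAcol : ∀ j, norm2 (fun i => A i j) ≤ 1)
    (hΔ : Convex ℝ Δ)
    (hβ : 0 < β) (hγl : 0 < γl) (hτ : 0 < τ)
    (hh : StronglyConvex β h)
    (hDh : IsGradient h Dh)
    -- h is μ-smooth
    (hhsmooth : ∀ x y : Fin n → ℝ, norm2 (Dh x - Dh y) ≤ μ * norm2 (x - y))
    (hlΔ : lstar ∈ Δ) (hl'Δ : lstar' ∈ Δ) (hltilΔ : ltil ∈ Δ)
    -- λ*' lies in the interior of Δ and satisfies the first-order optimality condition
    (hl'int : lstar' ∈ interior Δ)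
    (hfoc : Dh lstar' + Aᵀ *ᵥ wstar' = 0)
    -- (w*, λ*) approximate (w*', λ*')
    (hwτ : norm2 (wstar - wstar') ≤ τ) (hlτ : norm2 (lstar - lstar') ≤ τ)
    -- λ̃ maximizes λ ↦ −h(λ) − w*ᵀ A R Rᵀ λ − γ_λ‖λ‖₁ over Δ
    (hltil : ∀ lam ∈ Δ,
      -h lam - wstar ⬝ᵥ (A *ᵥ (R *ᵥ (Rᵀ *ᵥ lam))) - γl * norm1 lam
        ≤ -h ltil - wstar ⬝ᵥ (A *ᵥ (R *ᵥ (Rᵀ *ᵥ ltil))) - γl * norm1 ltil)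
    -- γ_λ ≥ 2 ρ_λ where ρ_λ = ‖(R Rᵀ − I) Aᵀ w*‖_∞ + (1+μ)τ
    (hγ : 2 * (normInf ((R * Rᵀ - 1) *ᵥ (Aᵀ *ᵥ wstar)) + (1 + μ) * τ) ≤ γl) :
    norm2 (ltil - lstar) ≤ 3 * γl * Real.sqrt (norm0 lstar) / β ∧
    norm1 (ltil - lstar) ≤ 12 * γl * (norm0 lstar : ℝ) / β ∧
    norm1 (ltil - lstar) ≤ 4 * Real.sqrt (norm0 lstar) * norm2 (ltil - lstar) := by
  refine sparse_error_bounds hβ hγl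
    (g := Dh lstar + (R * Rᵀ) *ᵥ (Aᵀ *ᵥ wstar)) (fun j => ?_) ?_
  · have : NeZero n := ⟨fun hn => by subst hn; exact j.elim0⟩
    have hμ := nonneg_of_norm2_sub_le hhsmooth
    have hdecomp : Dh lstar + (R * Rᵀ) *ᵥ (Aᵀ *ᵥ wstar) =
        (R * Rᵀ - 1) *ᵥ (Aᵀ *ᵥ wstar) + Aᵀ *ᵥ (wstar - wstar') + (Dh lstar - Dh lstar') := by
      rw [eq_neg_of_add_eq_zero_left hfoc, sub_mulVec, one_mulVec, mulVec_sub]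
      abel
    have hproj := abs_apply_le_normInf ((R * Rᵀ - 1) *ᵥ (Aᵀ *ᵥ wstar)) j
    have hprimal : |(Aᵀ *ᵥ (wstar - wstar')) j| ≤ 1 * τ :=
      (abs_dotProduct_le_norm2_mul_norm2 (fun i => A i j) (wstar - wstar')).trans
        (mul_le_mul (hAcol j) hwτ (norm2_nonneg _) zero_le_one)
    have hdual : |(Dh lstar - Dh lstar') j| ≤ μ * τ :=
      (abs_apply_le_norm2 _ j).trans
        ((hhsmooth _ _).trans (mul_le_mul_of_nonneg_left hlτ hμ))
    rw [hdecomp]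
    refine (abs_add_three _ _ _).trans ?_
    linarith
  · have hlin : ∀ lam, wstar ⬝ᵥ (A *ᵥ (R *ᵥ (Rᵀ *ᵥ lam))) =
        ((R * Rᵀ) *ᵥ (Aᵀ *ᵥ wstar)) ⬝ᵥ lam := fun lam => by
      rw [mulVec_mulVec lam R, dotProduct_mulVec, dotProduct_mulVec, ← mulVec_transpose A,
        ← mulVec_transpose (R * Rᵀ), transpose_mul, transpose_transpose]
    have hmax := hltil lstar hlΔ
    have hconv := hh.add_dotProduct_add_le hDh lstar ltil
    rw [hlin, hlin] at hmax
    rw [add_dotProduct, dotProduct_sub ((R * Rᵀ) *ᵥ (Aᵀ *ᵥ wstar))]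
    linarith
end
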